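/- Average pooling of a single sub-sampled GaussNet layer is translation insensitive: let K : ℤ² → ℝ be Lipschitz with constant L, let d ≥ 1 be a stride, let I : ℤ² → ℝ be finitely supported, and let f[I](x) = r(∑_{y} K(d·x − y)·I(y)). Then for any nonempty finite set F ⊆ ℤ² of N pixels and any shift s ∈ ℤ², |(1/N)·∑_{x ∈ F} f[T_s I](x) − (1/N)·∑_{x ∈ F} f[I](x)| ≤ C·‖s‖, where C = L · |supp(I)| · ‖I‖_∞ and ‖I‖_∞ = sup_y |I(y)|. -/

import Mathlib

/-- Euclidean norm of an integer shift `s ∈ ℤ²`. -/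
noncomputable def znorm (s : ℤ × ℤ) : ℝ :=
  Real.sqrt ((s.1 : ℝ) ^ 2 + (s.2 : ℝ) ^ 2)

/-- Translation of an image by `s`: `(T_s I)(x) = I(x + s)`. -/
def Tshift (s : ℤ × ℤ) (I : ℤ × ℤ → ℝ) : ℤ × ℤ → ℝ :=
  fun x => I (x + s)

/-- Rectified linear unit `r(t) = max(t, 0)`. -/
def relu (t : ℝ) : ℝ := max t 0

/-- Sub-sampled GaussNet layer with kernel `K` and stride `d`:
`f[I](x) = r(∑_{y} K(d·x − y)·I(y))`. -/
noncomputable def subLayer (K : ℤ × ℤ → ℝ) (d : ℤ) (I : ℤ × ℤ → ℝ) : ℤ × ℤ → ℝ :=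
  fun x => relu (∑' y : ℤ × ℤ, K (d • x - y) * I y)

theorem abs_relu_sub_relu_le (a b : ℝ) : |relu a - relu b| ≤ |a - b| :=
  abs_max_sub_max_le_abs a b 0

theorem tsum_mul_Tshift (K I : ℤ × ℤ → ℝ) (s z : ℤ × ℤ) :
    ∑' y : ℤ × ℤ, K (z - y) * Tshift s I y = ∑' y : ℤ × ℤ, K (z + s - y) * I y := by
  rw [← (Equiv.addRight s).tsum_eq (fun y => K (z + s - y) * I y)]
  refine tsum_congr fun y => ?_
  simp only [Equiv.coe_addRight, Tshift, add_sub_add_right_eq_sub]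

theorem tsum_mul_eq_sum_support (g I : ℤ × ℤ → ℝ) (hI : (Function.support I).Finite) :
    ∑' y : ℤ × ℤ, g y * I y = ∑ y ∈ hI.toFinset, g y * I y := by
  refine tsum_eq_sum fun y hy => ?_
  have hy0 : I y = 0 := by simpa using hy
  rw [hy0, mul_zero]

/-- Pointwise translation insensitivity of a sub-sampled layer. -/
theorem abs_subLayer_Tshift_sub_le (K : ℤ × ℤ → ℝ) (L : ℝ)
    (hK : ∀ a b : ℤ × ℤ, |K a - K b| ≤ L * znorm (a - b)) (d : ℤ)
    (I : ℤ × ℤ → ℝ) (hI : (Function.support I).Finite) (s x : ℤ × ℤ) :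
    |subLayer K d (Tshift s I) x - subLayer K d I x| ≤
      (L * (hI.toFinset.card : ℝ) * ⨆ y : ℤ × ℤ, |I y|) * znorm s := by
  have hbdd : BddAbove (Set.range fun y => |I y|) := by
    refine ⟨∑ y ∈ hI.toFinset, |I y|, ?_⟩
    rintro _ ⟨y, rfl⟩
    by_cases hy : I y = 0
    · simpa [hy] using Finset.sum_nonneg fun z (_ : z ∈ hI.toFinset) => abs_nonneg (I z)
    · exact Finset.single_le_sum (f := fun z => |I z|) (fun z _ => abs_nonneg _)
        (by simpa using hy)
  refine (abs_relu_sub_relu_le _ _).trans ?_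
  rw [tsum_mul_Tshift, tsum_mul_eq_sum_support _ I hI, tsum_mul_eq_sum_support _ I hI,
    ← Finset.sum_sub_distrib]
  calc |∑ y ∈ hI.toFinset, (K (d • x + s - y) * I y - K (d • x - y) * I y)|
      ≤ ∑ y ∈ hI.toFinset, |K (d • x + s - y) * I y - K (d • x - y) * I y| :=
        Finset.abs_sum_le_sum_abs _ _
    _ ≤ ∑ _y ∈ hI.toFinset, L * znorm s * ⨆ y : ℤ × ℤ, |I y| := by
        refine Finset.sum_le_sum fun y _ => ?_
        have hLip : |K (d • x + s - y) - K (d • x - y)| ≤ L * znorm s := by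
          have h := hK (d • x + s - y) (d • x - y)
          rwa [show d • x + s - y - (d • x - y) = s by abel] at h
        rw [← sub_mul, abs_mul]
        exact mul_le_mul hLip (le_ciSup hbdd y) (abs_nonneg _) ((abs_nonneg _).trans hLip)
    _ = (L * (hI.toFinset.card : ℝ) * ⨆ y : ℤ × ℤ, |I y|) * znorm s := by
        rw [Finset.sum_const, nsmul_eq_mul]
        ring

/-- Average pooling of a single sub-sampled GaussNet layer is translation
insensitive: for `K` `L`-Lipschitz, stride `d ≥ 1`, `I` finitely supported, any nonempty
finite pixel set `F` of `N` pixels and any shift `s`,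
`|(1/N)·∑_{x∈F} f[T_s I](x) − (1/N)·∑_{x∈F} f[I](x)| ≤ C·‖s‖` with
`C = L·|supp(I)|·‖I‖_∞`. -/
theorem subLayer_pooling_insensitive (K : ℤ × ℤ → ℝ) (L : ℝ)
    (hK : ∀ a b : ℤ × ℤ, |K a - K b| ≤ L * znorm (a - b))
    (d : ℤ) (hd : 1 ≤ d)
    (I : ℤ × ℤ → ℝ) (hI : (Function.support I).Finite)
    (F : Finset (ℤ × ℤ)) (hF : F.Nonempty) (s : ℤ × ℤ) :
    |(F.card : ℝ)⁻¹ * ∑ x ∈ F, subLayer K d (Tshift s I) x -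
        (F.card : ℝ)⁻¹ * ∑ x ∈ F, subLayer K d I x| ≤
      (L * (hI.toFinset.card : ℝ) * ⨆ y : ℤ × ℤ, |I y|) * znorm s := by
  have hN : (0 : ℝ) < F.card := by exact_mod_cast hF.card_pos
  rw [← mul_sub, ← Finset.sum_sub_distrib, abs_mul, abs_of_pos (inv_pos.mpr hN),
    inv_mul_le_iff₀ hN, ← nsmul_eq_mul]
  exact (Finset.abs_sum_le_sum_abs _ _).trans
    (Finset.sum_le_card_nsmul _ _ _ fun x _ => abs_subLayer_Tshift_sub_le K L hK d I hI s x)
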